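/- Let n ≥ 2 and let V be a nonnegative radial function in C(ℝⁿ) with V(r) = O(⟨r⟩^{-β}) for some β > 2 (where ⟨r⟩ = √(1+r²)), and V ∈ C^δ(B_δ) for some δ > 0; assume further that V is nontrivial when n = 2. Then there exists a C² solution φ₀ of Δφ₀ = Vφ₀ on ℝⁿ satisfying, for some constants 0 < c < C: c ln(r+2) ≤ φ₀(x) ≤ C ln(r+2) for all x when n = 2, and c ≤ φ₀(x) ≤ C for all x when n ≥ 3. Moreover, when n = 2 and V ≡ 0, the constant function φ₀ = 1 is a solution. -/

import Mathlib

open MeasureTheory Set Real Filter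
open scoped NNReal ENNReal

noncomputable section

abbrev Eucl (n : ℕ) := EuclideanSpace ℝ (Fin n)

/-- The Laplacian of `f : ℝⁿ → ℝ`, as the sum of the second partial derivatives. -/
noncomputable def lap {n : ℕ} (f : Eucl n → ℝ) (x : Eucl n) : ℝ :=
  ∑ i : Fin n, fderiv ℝ (fun y => fderiv ℝ f y (EuclideanSpace.single i 1)) x
    (EuclideanSpace.single i 1)

/-- The average of `t ↦ H (p t ^ 2)` over `[0, 1]` against `t ^ (n - 1)`: if `H (‖x‖ ^ 2)` is a
radial function on `ℝⁿ`, then `x ↦ radialMean n H (‖x‖ ^ 2) • x` is the radial vector field with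
divergence `H (‖x‖ ^ 2)`. -/
def radialMean (n : ℕ) (H : ℝ → ℝ) (p : ℝ) : ℝ :=
  ∫ u in (0 : ℝ)..1, u ^ (n - 1) * H (p * u ^ 2)

lemma continuous_radialMean (n : ℕ) {H : ℝ → ℝ} (hH : Continuous H) :
    Continuous (radialMean n H) := by
  unfold radialMean
  apply intervalIntegral.continuous_parametric_intervalIntegral_of_continuous'
  fun_prop

lemma radialMean_nonneg (n : ℕ) {H : ℝ → ℝ} (hH : ∀ q, 0 ≤ H q) (p : ℝ) :
    0 ≤ radialMean n H p :=
  intervalIntegral.integral_nonneg zero_le_one fun _ hu =>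
    mul_nonneg (pow_nonneg hu.1 _) (hH _)

lemma radialMean_pos (n : ℕ) {H : ℝ → ℝ} (hHc : Continuous H) (hH : ∀ q, 0 ≤ H q) {p : ℝ}
    (hp : 0 < H p) : 0 < radialMean n H p := by
  refine intervalIntegral.integral_pos zero_lt_one (by fun_prop)
    (fun _ hu => mul_nonneg (pow_nonneg hu.1.le _) (hH _)) ⟨1, by simp, by simpa using hp⟩

lemma mul_radialMean_zero {n : ℕ} (hn : 1 ≤ n) (H : ℝ → ℝ) : n * radialMean n H 0 = H 0 := by
  obtain ⟨m, rfl⟩ : ∃ m, n = m + 1 := ⟨n - 1, by omega⟩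
  have : ((m : ℝ) + 1) ≠ 0 := by positivity
  simp [radialMean, integral_pow]
  field_simp

lemma abs_radialMean_sub_le (n : ℕ) {H₁ H₂ : ℝ → ℝ} (h₁ : Continuous H₁) (h₂ : Continuous H₂)
    {p B : ℝ} (hp : 0 ≤ p) (hB : ∀ t, 0 ≤ t → t ≤ p → |H₁ t - H₂ t| ≤ B) :
    |radialMean n H₁ p - radialMean n H₂ p| ≤ B := by
  unfold radialMean
  rw [← intervalIntegral.integral_sub (Continuous.intervalIntegrable (by fun_prop) _ _)
    (Continuous.intervalIntegrable (by fun_prop) _ _)]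
  have := intervalIntegral.norm_integral_le_of_norm_le_const (a := (0 : ℝ)) (b := 1) (C := B)
    (f := fun u => u ^ (n - 1) * H₁ (p * u ^ 2) - u ^ (n - 1) * H₂ (p * u ^ 2)) ?_
  · simpa using this
  · intro u hu
    rw [uIoc_of_le zero_le_one] at hu
    have hu2 : u ^ 2 ≤ 1 := pow_le_one₀ hu.1.le hu.2
    have hb := hB (p * u ^ 2) (by positivity) (mul_le_of_le_one_right hp hu2)
    rw [← mul_sub, norm_mul, norm_pow, Real.norm_eq_abs, Real.norm_eq_abs, abs_of_pos hu.1]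
    calc u ^ (n - 1) * |H₁ (p * u ^ 2) - H₂ (p * u ^ 2)|
        ≤ 1 * |H₁ (p * u ^ 2) - H₂ (p * u ^ 2)| := by
          gcongr; exact pow_le_one₀ hu.1.le hu.2
      _ ≤ B := by rwa [one_mul]

lemma pow_mul_radialMean_sq {n : ℕ} (hn : 1 ≤ n) (H : ℝ → ℝ) (s : ℝ) :
    s ^ n * radialMean n H (s ^ 2) = ∫ t in (0 : ℝ)..s, t ^ (n - 1) * H (t ^ 2) := by
  obtain ⟨m, rfl⟩ : ∃ m, n = m + 1 := ⟨n - 1, by omega⟩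
  have h := intervalIntegral.mul_integral_comp_mul_left (a := (0 : ℝ)) (b := 1) (c := s)
    (f := fun t => t ^ m * H (t ^ 2))
  rw [mul_zero, mul_one] at h
  simp only [radialMean, Nat.add_sub_cancel]
  rw [← h, pow_succ', mul_assoc, ← intervalIntegral.integral_const_mul]
  simp only [mul_pow, mul_assoc]

lemma hasDerivAt_radialMean {n : ℕ} (hn : 1 ≤ n) {H : ℝ → ℝ} (hH : Continuous H) {p : ℝ}
    (hp : 0 < p) :
    HasDerivAt (radialMean n H) ((H p - n * radialMean n H p) / (2 * p)) p := by
  have hs : 0 < √p := Real.sqrt_pos.2 hp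
  have hsq : √p ^ 2 = p := Real.sq_sqrt hp.le
  have hJ : HasDerivAt (fun s => ∫ t in (0 : ℝ)..s, t ^ (n - 1) * H (t ^ 2))
      (√p ^ (n - 1) * H (√p ^ 2)) (√p) :=
    intervalIntegral.integral_hasDerivAt_right (Continuous.intervalIntegrable (by fun_prop) _ _)
      (Continuous.stronglyMeasurableAtFilter (by fun_prop) _ _) (by fun_prop)
  have hsqrt := (Real.hasDerivAt_sqrt hp.ne')
  have hq := (hJ.div (hasDerivAt_pow n (√p)) (pow_ne_zero n hs.ne')).comp p hsqrt
  have heq : radialMean n H =ᶠ[nhds p]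
      ((fun s => ∫ t in (0 : ℝ)..s, t ^ (n - 1) * H (t ^ 2)) / fun s => s ^ n) ∘ Real.sqrt := by
    filter_upwards [lt_mem_nhds hp] with q hq
    have : √q ^ n ≠ 0 := pow_ne_zero n (Real.sqrt_pos.2 hq).ne'
    simp only [Function.comp, Pi.div_apply]
    rw [← pow_mul_radialMean_sq hn, Real.sq_sqrt hq.le]
    field_simp
  refine (hq.congr_of_eventuallyEq heq).congr_deriv ?_
  rw [← pow_mul_radialMean_sq hn, hsq]
  obtain ⟨m, rfl⟩ : ∃ m, n = m + 1 := ⟨n - 1, by omega⟩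
  simp only [Nat.add_sub_cancel]
  generalize radialMean (m + 1) H p = K
  generalize H p = h
  clear hJ hq hsqrt heq
  generalize √p = s at hs hsq
  subst hsq
  field_simp
  ring

/-- A Grönwall bound for a coefficient with integrable polynomial decay. -/
lemma le_mul_exp_of_deriv_le {F F' : ℝ → ℝ} {a D γ : ℝ} (ha : 0 ≤ a) (hD : 0 ≤ D) (hγ : 1 < γ)
    (hF : ∀ q, a ≤ q → HasDerivAt F (F' q) q) (hpos : ∀ q, a ≤ q → 0 ≤ F q)
    (hle : ∀ q, a ≤ q → F' q ≤ D * (1 + q) ^ (-γ) * F q) {q : ℝ} (hq : a ≤ q) :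
    F q ≤ F a * exp (D / (γ - 1)) := by
  have hγ' : 0 < γ - 1 := by linarith
  set B : ℝ → ℝ := fun q => D / (γ - 1) * (1 + q) ^ (1 - γ) with hB
  have hBd : ∀ q, a ≤ q → HasDerivAt B (-(D * (1 + q) ^ (-γ))) q := by
    intro q hq
    have h1 : HasDerivAt (fun q : ℝ => 1 + q) 1 q := (hasDerivAt_id q).const_add 1
    have h2 := (h1.rpow_const (p := 1 - γ) (Or.inl (by linarith))).const_mul (D / (γ - 1))
    refine h2.congr_deriv ?_
    rw [show 1 - γ - 1 = -γ by ring]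
    field_simp
    ring
  have hY : ∀ q, a ≤ q → HasDerivAt (fun q => F q * exp (B q))
      ((F' q - D * (1 + q) ^ (-γ) * F q) * exp (B q)) q := fun q hq =>
    ((hF q hq).mul (hBd q hq).exp).congr_deriv (by ring)
  have hanti : AntitoneOn (fun q => F q * exp (B q)) (Ici a) := by
    refine antitoneOn_of_hasDerivWithinAt_nonpos (convex_Ici a)
      (fun q hq => (hY q hq).continuousAt.continuousWithinAt)
      (fun q hq => (hY q (interior_subset hq)).hasDerivWithinAt) fun q hq => ?_
    exact mul_nonpos_of_nonpos_of_nonneg (sub_nonpos.2 (hle q (interior_subset hq)))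
      (exp_pos _).le
  have hB0 : 0 ≤ B q := by have : 0 ≤ 1 + q := by linarith
                           positivity
  have hBa : B a ≤ D / (γ - 1) :=
    mul_le_of_le_one_right (by positivity)
      (Real.rpow_le_one_of_one_le_of_nonpos (by linarith) (by linarith))
  calc F q ≤ F q * exp (B q) := le_mul_of_one_le_right (hpos q hq) (Real.one_le_exp hB0)
    _ ≤ F a * exp (B a) := hanti self_mem_Ici hq hq
    _ ≤ F a * exp (D / (γ - 1)) := by
      have := hpos a le_rfl
      gcongr

/-- The equation `Δ (G (‖x‖ ^ 2)) = W (‖x‖ ^ 2) G (‖x‖ ^ 2)`, `G 0 = 1`, in integrated form. -/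
lemma exists_radial_profile (n : ℕ) {W : ℝ → ℝ} (hWc : Continuous W) (hW : ∀ q, 0 ≤ W q)
    {M : ℝ} (hWM : ∀ q, W q ≤ M) :
    ∃ G H : ℝ → ℝ, Continuous H ∧ (∀ q, 0 ≤ H q) ∧ (∀ q, 0 ≤ q → H q = W q * G q) ∧ G 0 = 1 ∧
      ∀ q, HasDerivAt G (radialMean n H q / 2) q := by
  wlog hM : 0 < M generalizing M
  · exact this (M := M ⊔ 1) (fun q => (hWM q).trans le_sup_left) (by positivity)
  let H : BoundedContinuousFunction ℝ ℝ → ℝ → ℝ := fun g q => W q * |exp (M * max q 0) * g q|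
  have hHc : ∀ g, Continuous (H g) := fun g => by
    have := g.continuous
    fun_prop
  have hHd : ∀ g g' q, 0 ≤ q → |H g q - H g' q| ≤ M * exp (M * q) * dist g g' := by
    intro g g' q hq
    simp only [H, max_eq_left hq]
    rw [← mul_sub, abs_mul, abs_of_nonneg (hW q), mul_assoc]
    refine mul_le_mul (hWM q) ?_ (abs_nonneg _) hM.le
    refine (abs_abs_sub_abs_le_abs_sub _ _).trans ?_
    rw [← mul_sub, abs_mul, abs_of_pos (exp_pos _)]
    gcongr
    exact g.dist_coe_le_dist q
  let P : BoundedContinuousFunction ℝ ℝ → ℝ → ℝ := fun g q =>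
    1 + (∫ p in (0 : ℝ)..q, radialMean n (H g) p) / 2
  have hPc : ∀ g, Continuous (P g) := fun g => by
    have := intervalIntegral.continuous_primitive
      (fun a b => (continuous_radialMean n (hHc g)).intervalIntegrable (μ := volume) a b) 0
    fun_prop
  have hPd : ∀ g g' q, 0 ≤ q → |exp (-(M * q)) * P g q - exp (-(M * q)) * P g' q| ≤
      dist g g' / 2 := by
    intro g g' q hq
    have hexp : (∫ p in (0 : ℝ)..q, M * exp (M * p) * dist g g') =
        (exp (M * q) - 1) * dist g g' := by
      rw [intervalIntegral.integral_mul_const]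
      congr 1
      rw [intervalIntegral.integral_eq_sub_of_hasDerivAt (f := fun p => exp (M * p))]
      · simp
      · intro p _
        exact (((hasDerivAt_id p).const_mul M).exp).congr_deriv (by simp; ring)
      · exact Continuous.intervalIntegrable (by fun_prop) _ _
    have hint : |(∫ p in (0 : ℝ)..q, radialMean n (H g) p) -
        ∫ p in (0 : ℝ)..q, radialMean n (H g') p| ≤ (exp (M * q) - 1) * dist g g' := by
      rw [← intervalIntegral.integral_sub
        ((continuous_radialMean n (hHc g)).intervalIntegrable _ _)
        ((continuous_radialMean n (hHc g')).intervalIntegrable _ _), ← hexp,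
        ← Real.norm_eq_abs]
      have hcont : Continuous fun p => M * exp (M * p) * dist g g' := by fun_prop
      refine intervalIntegral.norm_integral_le_of_norm_le hq (ae_of_all _ fun p hp => ?_)
        (hcont.intervalIntegrable (μ := volume) 0 q)
      refine abs_radialMean_sub_le n (hHc g) (hHc g') hp.1.le fun t ht htp => ?_
      refine (hHd g g' t ht).trans ?_
      gcongr
    have hPP : |P g q - P g' q| ≤ exp (M * q) * dist g g' / 2 := by
      have : P g q - P g' q = ((∫ p in (0 : ℝ)..q, radialMean n (H g) p) -
        ∫ p in (0 : ℝ)..q, radialMean n (H g') p) / 2 := by simp only [P]; ring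
      rw [this, abs_div, abs_two]
      gcongr
      refine hint.trans ?_
      gcongr
      linarith
    rw [← mul_sub, abs_mul, abs_of_pos (exp_pos _)]
    calc exp (-(M * q)) * |P g q - P g' q|
        ≤ exp (-(M * q)) * (exp (M * q) * dist g g' / 2) := by gcongr
      _ = dist g g' / 2 := by
        rw [exp_neg]; field_simp
  have hP0 : ∀ q, P 0 q = 1 := fun q => by simp [P, H, radialMean]
  let T : BoundedContinuousFunction ℝ ℝ → BoundedContinuousFunction ℝ ℝ := fun g =>
    BoundedContinuousFunction.ofNormedAddCommGroup
      (fun q => exp (-(M * max q 0)) * P g (max q 0))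
      (by have := hPc g; fun_prop) (1 + dist g 0 / 2) (by
        intro q
        have h := hPd g 0 (max q 0) (le_max_right _ _)
        have hle : exp (-(M * max q 0)) ≤ 1 := by
          rw [Real.exp_le_one_iff]
          have := le_max_right q 0
          nlinarith
        rw [hP0, mul_one] at h
        rw [Real.norm_eq_abs]
        have h2 := abs_sub_abs_le_abs_sub (exp (-(M * max q 0)) * P g (max q 0))
          (exp (-(M * max q 0)))
        rw [abs_of_pos (exp_pos (-(M * max q 0)))] at h2
        linarith)
  have hT : ContractingWith (1 / 2) T := by
    refine ⟨by norm_num, LipschitzWith.of_dist_le_mul fun g g' => ?_⟩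
    refine (BoundedContinuousFunction.dist_le (by positivity)).2 fun q => ?_
    refine (hPd g g' (max q 0) (le_max_right _ _)).trans (le_of_eq ?_)
    push_cast
    ring
  obtain ⟨g, hg⟩ : ∃ g, T g = g := ⟨_, hT.fixedPoint_isFixedPt⟩
  have hH0 : ∀ q, 0 ≤ H g q := fun q => mul_nonneg (hW q) (abs_nonneg _)
  refine ⟨P g, H g, hHc g, hH0, fun q hq => ?_, by simp [P], fun q => ?_⟩
  · have hgq : exp (M * q) * g q = P g q := by
      have : g q = exp (-(M * q)) * P g q := by
        conv_lhs => rw [← hg]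
        simp [T, max_eq_left hq]
      rw [this, exp_neg]
      field_simp
    have hPpos : 0 ≤ P g q := by
      have : 0 ≤ ∫ p in (0 : ℝ)..q, radialMean n (H g) p :=
        intervalIntegral.integral_nonneg hq fun p _ => radialMean_nonneg n hH0 p
      simp only [P]
      positivity
    simp only [H, max_eq_left hq]
    rw [hgq, abs_of_nonneg hPpos]
  · have hc := continuous_radialMean n (hHc g)
    exact ((intervalIntegral.integral_hasDerivAt_right (hc.intervalIntegrable _ _)
      (hc.stronglyMeasurableAtFilter _ _) hc.continuousAt).div_const 2).const_add 1

/-- The derivative of the vector field `x ↦ radialMean n H (‖x‖ ^ 2) • x`. -/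
def radialFieldDeriv (n : ℕ) (H : ℝ → ℝ) (x : Eucl n) : Eucl n →L[ℝ] Eucl n :=
  radialMean n H (‖x‖ ^ 2) • ContinuousLinearMap.id ℝ (Eucl n) +
    ((H (‖x‖ ^ 2) - n * radialMean n H (‖x‖ ^ 2)) / ‖x‖ ^ 2) • (innerSL ℝ x).smulRight x

lemma hasFDerivAt_radialField {n : ℕ} (hn : 1 ≤ n) {H : ℝ → ℝ} (hH : Continuous H)
    (x : Eucl n) :
    HasFDerivAt (fun y : Eucl n => radialMean n H (‖y‖ ^ 2) • y) (radialFieldDeriv n H x) x := by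
  have hK := continuous_radialMean n hH
  rcases eq_or_ne x 0 with rfl | hx
  · have h0 : radialFieldDeriv n H 0 = radialMean n H 0 • ContinuousLinearMap.id ℝ (Eucl n) := by
      simp [radialFieldDeriv]
    rw [h0, hasFDerivAt_iff_isLittleO_nhds_zero]
    have ht : Tendsto (fun y : Eucl n => radialMean n H (‖y‖ ^ 2) - radialMean n H 0)
        (nhds 0) (nhds 0) := by
      have : Continuous fun y : Eucl n => radialMean n H (‖y‖ ^ 2) - radialMean n H 0 := by
        fun_prop
      simpa using this.tendsto 0
    have := ((Asymptotics.isLittleO_one_iff ℝ).2 ht).smul_isBigO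
      (Asymptotics.isBigO_refl (fun y : Eucl n => y) (nhds 0))
    simpa [sub_smul] using this
  · have hp : 0 < ‖x‖ ^ 2 := by positivity
    have h1 := (hasDerivAt_radialMean hn hH hp).comp_hasFDerivAt x
      (hasStrictFDerivAt_norm_sq x).hasFDerivAt
    refine (h1.smul (hasFDerivAt_id x)).congr_fderiv ?_
    ext y i
    simp [radialFieldDeriv]
    field_simp

lemma continuous_radialFieldDeriv {n : ℕ} (hn : 1 ≤ n) {H : ℝ → ℝ} (hH : Continuous H) :
    Continuous (radialFieldDeriv n H) := by
  have hK := continuous_radialMean n hH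
  refine Continuous.add (by fun_prop) (continuous_iff_continuousAt.2 fun x => ?_)
  have hr : Continuous fun x : Eucl n => (innerSL ℝ x).smulRight x :=
    (ContinuousLinearMap.smulRightL ℝ (Eucl n) (Eucl n)).continuous₂.comp
      ((innerSL ℝ).continuous.prodMk continuous_id)
  rcases eq_or_ne x 0 with rfl | hx
  · have hz : Tendsto (fun x : Eucl n => |H (‖x‖ ^ 2) - n * radialMean n H (‖x‖ ^ 2)|)
        (nhds 0) (nhds 0) := by
      have : Continuous fun x : Eucl n => |H (‖x‖ ^ 2) - n * radialMean n H (‖x‖ ^ 2)| := by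
        fun_prop
      simpa [mul_radialMean_zero hn] using this.tendsto 0
    unfold ContinuousAt
    simp only [map_zero, ContinuousLinearMap.smulRight_zero, smul_zero]
    refine squeeze_zero_norm (fun y => ?_) hz
    rw [norm_smul, ContinuousLinearMap.norm_smulRight_apply, innerSL_apply_norm, norm_div,
      Real.norm_eq_abs, norm_pow, norm_norm, ← sq]
    rcases eq_or_ne y 0 with rfl | hy
    · simp
    · rw [div_mul_cancel₀ _ (by positivity)]
  · have : ‖x‖ ^ 2 ≠ 0 := by positivity
    have hnum : Continuous fun x : Eucl n => H (‖x‖ ^ 2) - n * radialMean n H (‖x‖ ^ 2) := by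
      fun_prop
    have hden : Continuous fun x : Eucl n => ‖x‖ ^ 2 := by fun_prop
    exact (hnum.continuousAt.div hden.continuousAt this).smul hr.continuousAt

section

variable {n : ℕ} {G H : ℝ → ℝ}

lemma hasFDerivAt_radial (hG : ∀ q, HasDerivAt G (radialMean n H q / 2) q) (x : Eucl n) :
    HasFDerivAt (fun y : Eucl n => G (‖y‖ ^ 2)) (innerSL ℝ (radialMean n H (‖x‖ ^ 2) • x)) x := by
  refine ((hG _).comp_hasFDerivAt x (hasStrictFDerivAt_norm_sq x).hasFDerivAt).congr_fderiv ?_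
  ext y
  simp
  ring

lemma contDiff_radial (hn : 1 ≤ n) (hH : Continuous H)
    (hG : ∀ q, HasDerivAt G (radialMean n H q / 2) q) :
    ContDiff ℝ 2 fun x : Eucl n => G (‖x‖ ^ 2) := by
  have hF : ContDiff ℝ 1 fun x : Eucl n => radialMean n H (‖x‖ ^ 2) • x := by
    rw [contDiff_one_iff_fderiv]
    refine ⟨fun x => (hasFDerivAt_radialField hn hH x).differentiableAt, ?_⟩
    rw [funext fun x => (hasFDerivAt_radialField hn hH x).fderiv]
    exact continuous_radialFieldDeriv hn hH
  rw [show (2 : WithTop ℕ∞) = 1 + 1 by norm_num, contDiff_succ_iff_fderiv]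
  refine ⟨fun x => (hasFDerivAt_radial hG x).differentiableAt, by simp, ?_⟩
  rw [funext fun x => (hasFDerivAt_radial hG x).fderiv]
  exact (innerSL ℝ).contDiff.comp hF

lemma lap_radial (hn : 1 ≤ n) (hH : Continuous H)
    (hG : ∀ q, HasDerivAt G (radialMean n H q / 2) q) (x : Eucl n) :
    lap (fun x : Eucl n => G (‖x‖ ^ 2)) x = H (‖x‖ ^ 2) := by
  unfold lap
  have h1 : ∀ i : Fin n, fderiv ℝ (fun y => fderiv ℝ (fun x : Eucl n => G (‖x‖ ^ 2)) y
      (EuclideanSpace.single i 1)) x (EuclideanSpace.single i 1) =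
      radialMean n H (‖x‖ ^ 2) +
        (H (‖x‖ ^ 2) - n * radialMean n H (‖x‖ ^ 2)) / ‖x‖ ^ 2 * x i ^ 2 := by
    intro i
    have h2 : (fun y => fderiv ℝ (fun x : Eucl n => G (‖x‖ ^ 2)) y
        (EuclideanSpace.single i 1)) =
        fun y => EuclideanSpace.proj (𝕜 := ℝ) i (radialMean n H (‖y‖ ^ 2) • y) := by
      ext y
      rw [(hasFDerivAt_radial hG y).fderiv]
      simp [EuclideanSpace.inner_single_right]
    have h3 := (EuclideanSpace.proj (𝕜 := ℝ) i).hasFDerivAt.comp x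
      (hasFDerivAt_radialField hn hH x)
    rw [h2]
    erw [h3.fderiv]
    simp [radialFieldDeriv, EuclideanSpace.inner_single_right]
    exact Or.inl (by ring)
  rw [Finset.sum_congr rfl fun i _ => h1 i, Finset.sum_add_distrib, ← Finset.mul_sum,
    ← EuclideanSpace.real_norm_sq_eq]
  rcases eq_or_ne x 0 with rfl | hx
  · simp [mul_radialMean_zero hn]
  · have : ‖x‖ ^ 2 ≠ 0 := by positivity
    rw [div_mul_cancel₀ _ this]
    simp

end

section

variable {n : ℕ} {G H : ℝ → ℝ}

lemma monotone_of_radial (hH0 : ∀ q, 0 ≤ H q)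
    (hG : ∀ q, HasDerivAt G (radialMean n H q / 2) q) : Monotone G :=
  monotone_of_deriv_nonneg (fun q => (hG q).differentiableAt) fun q => by
    rw [(hG q).deriv]
    exact div_nonneg (radialMean_nonneg n hH0 q) zero_le_two

lemma hasDerivAt_mul_radialMean (hn : 1 ≤ n) (hH : Continuous H) {q : ℝ} (hq : 0 < q) :
    HasDerivAt (fun q => q * radialMean n H q)
      (radialMean n H q + (H q - n * radialMean n H q) / 2) q := by
  refine ((hasDerivAt_id q).mul (hasDerivAt_radialMean hn hH hq)).congr_deriv ?_
  simp
  field_simp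

variable {W : ℝ → ℝ} {A α : ℝ}

lemma radial_le_of_three_le (hn : 3 ≤ n) (hH : Continuous H) (hH0 : ∀ q, 0 ≤ H q)
    (hHW : ∀ q, 0 ≤ q → H q = W q * G q) (hG0 : G 0 = 1)
    (hG : ∀ q, HasDerivAt G (radialMean n H q / 2) q) (hA : 0 ≤ A) (hα : 1 < α)
    (hW : ∀ q, 0 ≤ q → W q ≤ A * (1 + q) ^ (-α)) :
    ∃ C, ∀ q, 0 ≤ q → G q ≤ C := by
  have hmono := monotone_of_radial hH0 hG
  have hG1 : ∀ q, 0 ≤ q → 1 ≤ G q := fun q hq => hG0 ▸ hmono hq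
  have hK0 := radialMean_nonneg n hH0
  have hn' : (1 : ℝ) ≤ n - 2 := by
    have : (3 : ℝ) ≤ n := by exact_mod_cast hn
    linarith
  set E : ℝ → ℝ := fun q => (n - 2) * G q + q * radialMean n H q with hE
  have hGE : ∀ q, 0 ≤ q → G q ≤ E q := fun q hq => by
    have := mul_nonneg hq (hK0 q)
    have := hG1 q hq
    simp only [hE]
    nlinarith
  have hEd : ∀ q, 1 ≤ q → HasDerivAt E (W q * G q / 2) q := fun q hq => by
    refine (((hG q).const_mul ((n : ℝ) - 2)).add (hasDerivAt_mul_radialMean (by omega) hH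
      (by linarith : 0 < q))).congr_deriv ?_
    rw [← hHW q (by linarith)]
    ring
  refine ⟨E 1 * exp (A / (α - 1)), fun q hq => ?_⟩
  refine (hmono (le_max_left q 1)).trans ((hGE _ (by positivity)).trans ?_)
  refine le_mul_exp_of_deriv_le zero_le_one hA hα hEd
    (fun q hq => (hG1 q (by linarith)).trans (hGE q (by linarith)) |>.trans' zero_le_one)
    (fun q hq => ?_) (le_max_right q 1)
  have hq0 : 0 ≤ q := by linarith
  have h1 := hG1 q hq0
  have h2 : 0 ≤ W q * G q := hHW q hq0 ▸ hH0 q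
  calc W q * G q / 2 ≤ W q * G q := by linarith
    _ ≤ A * (1 + q) ^ (-α) * G q := by gcongr; exact hW q hq0
    _ ≤ A * (1 + q) ^ (-α) * E q := by gcongr; exact hGE q hq0

lemma radial_two_le_log (hH : Continuous H) (hH0 : ∀ q, 0 ≤ H q)
    (hHW : ∀ q, 0 ≤ q → H q = W q * G q) (hG0 : G 0 = 1)
    (hG : ∀ q, HasDerivAt G (radialMean 2 H q / 2) q) (hA : 0 ≤ A) (hα : 1 < α)
    (hW : ∀ q, 0 ≤ q → W q ≤ A * (1 + q) ^ (-α)) :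
    ∃ C, ∀ r, 0 ≤ r → G (r ^ 2) ≤ C * log (r + 2) := by
  have hmono := monotone_of_radial hH0 hG
  have hG1 : ∀ q, 0 ≤ q → 1 ≤ G q := fun q hq => hG0 ▸ hmono hq
  have hK0 := radialMean_nonneg 2 hH0
  set E : ℝ → ℝ := fun q => q * radialMean 2 H q with hE
  have hE0 : ∀ q, 0 ≤ q → 0 ≤ E q := fun q hq => mul_nonneg hq (hK0 q)
  have hEd : ∀ q, 1 ≤ q → HasDerivAt E (W q * G q / 2) q := fun q hq => by
    refine (hasDerivAt_mul_radialMean one_le_two hH (by linarith : 0 < q)).congr_deriv ?_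
    rw [← hHW q (by linarith)]
    push_cast
    ring
  have hWG : ∀ q, 0 ≤ q → 0 ≤ W q * G q := fun q hq => hHW q hq ▸ hH0 q
  have hlog : ∀ q, 1 ≤ q → G q ≤ G 1 + E q * log q := by
    have hanti : AntitoneOn (fun q => G q - E q * log q / 2) (Ici 1) := by
      have hd : ∀ q, 1 ≤ q → HasDerivAt (fun q => G q - E q * log q / 2)
          (-(W q * G q / 2 * log q / 2)) q := fun q hq => by
        have hq0 : q ≠ 0 := by positivity
        refine ((hG q).sub (((hEd q hq).mul (Real.hasDerivAt_log hq0)).div_const 2)).congr_deriv ?_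
        simp only [hE]
        field_simp
        ring
      refine antitoneOn_of_hasDerivWithinAt_nonpos (convex_Ici 1)
        (fun q hq => (hd q hq).continuousAt.continuousWithinAt)
        (fun q hq => (hd q (interior_subset hq)).hasDerivWithinAt) fun q hq => ?_
      have hq1 : 1 ≤ q := interior_subset hq
      have := hWG q (by linarith)
      have := Real.log_nonneg hq1
      rw [neg_nonpos]
      positivity
    intro q hq
    have h := hanti self_mem_Ici hq hq
    simp only [Real.log_one, mul_zero, zero_div, sub_zero] at h
    have := mul_nonneg (hE0 q (by linarith)) (Real.log_nonneg hq)
    linarith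
  set ε := (α - 1) / 2 with hε
  have hεpos : 0 < ε := by simp only [hε]; linarith
  set F : ℝ → ℝ := fun q => E q + G 1 with hF
  have hF0 : ∀ q, 0 ≤ q → 0 ≤ F q := fun q hq =>
    add_nonneg (hE0 q hq) (zero_le_one.trans (hG1 1 zero_le_one))
  have hFbd : ∀ q, 1 ≤ q → F q ≤ F 1 * exp (A * (1 + 1 / ε) / (α - ε - 1)) := by
    intro q hq
    refine le_mul_exp_of_deriv_le zero_le_one (by positivity) (by simp only [hε]; linarith)
      (fun q hq => (hEd q hq).add_const _) (fun q hq => hF0 q (by linarith)) (fun q hq => ?_) hq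
    have hq0 : 0 ≤ q := by linarith
    have hG1' := hG1 1 zero_le_one
    have hl0 := Real.log_nonneg hq
    have hEq := hE0 q hq0
    have hone : 1 ≤ (1 + q) ^ ε := Real.one_le_rpow (by linarith) hεpos.le
    have hl : log q ≤ (1 + q) ^ ε / ε :=
      (Real.log_le_rpow_div hq0 hεpos).trans (by gcongr; linarith)
    have hw : 1 + log q ≤ (1 + 1 / ε) * (1 + q) ^ ε := by
      rw [add_mul, one_mul, one_div_mul_eq_div]
      linarith
    have hGF : G q ≤ (1 + log q) * F q := by
      refine (hlog q hq).trans ?_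
      simp only [hF]
      nlinarith
    have hFq := hF0 q hq0
    calc W q * G q / 2 ≤ W q * G q := by linarith [hWG q hq0]
      _ ≤ A * (1 + q) ^ (-α) * G q := by
        have := hG1 q hq0
        gcongr
        exact hW q hq0
      _ ≤ A * (1 + q) ^ (-α) * ((1 + 1 / ε) * (1 + q) ^ ε * F q) := by
        gcongr
        exact hGF.trans (by gcongr)
      _ = A * (1 + 1 / ε) * (1 + q) ^ (-(α - ε)) * F q := by
        rw [show -(α - ε) = -α + ε by ring, Real.rpow_add (by linarith)]
        ring
  set B := F 1 * exp (A * (1 + 1 / ε) / (α - ε - 1)) with hB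
  have hB0 : 0 ≤ B := mul_nonneg (hF0 1 zero_le_one) (exp_pos _).le
  have hl2 : 0 < log 2 := Real.log_pos one_lt_two
  have hG1' := hG1 1 zero_le_one
  refine ⟨G 1 / log 2 + 2 * B, fun r hr => ?_⟩
  have hlr : log 2 ≤ log (r + 2) := Real.log_le_log two_pos (by linarith)
  have hfirst : G 1 ≤ G 1 / log 2 * log (r + 2) := by
    rw [div_mul_eq_mul_div, le_div_iff₀ hl2]
    gcongr
  rw [add_mul]
  rcases le_total r 1 with h | h
  · have : G (r ^ 2) ≤ G 1 := hmono (pow_le_one₀ hr h)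
    have : 0 ≤ 2 * B * log (r + 2) :=
      mul_nonneg (by positivity) (hl2.le.trans hlr)
    linarith
  · have hr2 : 1 ≤ r ^ 2 := one_le_pow₀ h
    have h1 := hlog _ hr2
    have h2 : E (r ^ 2) ≤ B := by
      have := hFbd _ hr2
      simp only [hF] at this ⊢
      linarith
    have h3 : log (r ^ 2) ≤ 2 * log (r + 2) := by
      rw [Real.log_pow]
      push_cast
      gcongr
      linarith
    have h4 : E (r ^ 2) * log (r ^ 2) ≤ B * (2 * log (r + 2)) :=
      mul_le_mul h2 h3 (Real.log_nonneg hr2) hB0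
    linarith

lemma log_le_radial_two (hH : Continuous H) (hH0 : ∀ q, 0 ≤ H q) (hG0 : G 0 = 1)
    (hG : ∀ q, HasDerivAt G (radialMean 2 H q / 2) q) {q₀ : ℝ} (hq₀ : 0 ≤ q₀) (hpos : 0 < H q₀) :
    ∃ c, 0 < c ∧ ∀ r, 0 ≤ r → c * log (r + 2) ≤ G (r ^ 2) := by
  have hmono := monotone_of_radial hH0 hG
  have hK := continuous_radialMean 2 hH
  obtain ⟨q₁, hq₁, hKq₁⟩ := (hK.continuousAt.eventually
    (lt_mem_nhds (radialMean_pos 2 hH hH0 hpos))).exists_gt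
  have hq₁0 : 0 < q₁ := hq₀.trans_lt hq₁
  have hEmono : MonotoneOn (fun q => q * radialMean 2 H q) (Ici q₁) := by
    have hd : ∀ q, q₁ ≤ q → HasDerivAt (fun q => q * radialMean 2 H q) (H q / 2) q :=
      fun q hq => (hasDerivAt_mul_radialMean one_le_two hH (hq₁0.trans_le hq)).congr_deriv
        (by push_cast; ring)
    exact monotoneOn_of_hasDerivWithinAt_nonneg (convex_Ici _)
      (fun q hq => (hd q hq).continuousAt.continuousWithinAt)
      (fun q hq => (hd q (interior_subset hq)).hasDerivWithinAt)
      fun q _ => div_nonneg (hH0 q) zero_le_two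
  set ε := q₁ * radialMean 2 H q₁ with hε
  have hε0 : 0 < ε := mul_pos hq₁0 hKq₁
  have hL : ∀ q : ℝ, 0 ≤ q → 0 < log (q + 3) := fun q hq => Real.log_pos (by linarith)
  set c := min (ε / 2) (1 / log (q₁ + 3)) with hc
  have hc0 : 0 < c := lt_min (by positivity) (one_div_pos.2 (hL _ hq₁0.le))
  have hbase : c * log (q₁ + 3) ≤ 1 := by
    have := min_le_right (ε / 2) (1 / log (q₁ + 3))
    rwa [← hc, le_div_iff₀ (hL _ hq₁0.le)] at this
  have hcmp : MonotoneOn (fun q => G q - c * log (q + 3)) (Ici q₁) := by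
    have hd : ∀ q, q₁ ≤ q → HasDerivAt (fun q => G q - c * log (q + 3))
        (radialMean 2 H q / 2 - c * (1 / (q + 3))) q := fun q hq =>
      (hG q).sub ((((hasDerivAt_id q).add_const 3).log (by simp; linarith)).const_mul c)
    refine monotoneOn_of_hasDerivWithinAt_nonneg (convex_Ici _)
      (fun q hq => (hd q hq).continuousAt.continuousWithinAt)
      (fun q hq => (hd q (interior_subset hq)).hasDerivWithinAt) fun q hq => ?_
    have hq : q₁ ≤ q := interior_subset hq
    have hq0 : 0 < q := hq₁0.trans_le hq
    have h1 : ε ≤ q * radialMean 2 H q := hEmono self_mem_Ici hq hq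
    have h2 : c ≤ ε / 2 := min_le_left _ _
    have hK0 := radialMean_nonneg 2 hH0 q
    rw [sub_nonneg, mul_one_div, div_le_iff₀ (by linarith)]
    nlinarith
  have hG3 : ∀ q, 0 ≤ q → c * log (q + 3) ≤ G q := by
    intro q hq
    have hG1 : ∀ q, 0 ≤ q → 1 ≤ G q := fun q hq => hG0 ▸ hmono hq
    rcases le_total q q₁ with h | h
    · calc c * log (q + 3) ≤ c * log (q₁ + 3) := by gcongr
        _ ≤ 1 := hbase
        _ ≤ G q := hG1 q hq
    · have h3 := hcmp self_mem_Ici h h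
      have h4 := hG1 q₁ hq₁0.le
      simp only at h3
      linarith
  refine ⟨c, hc0, fun r hr => le_trans ?_ (hG3 _ (sq_nonneg r))⟩
  exact mul_le_mul_of_nonneg_left
    (Real.log_le_log (by linarith) (by nlinarith [sq_nonneg (r - 1)])) hc0.le

end

/-- Lemma 2.2: for a nonnegative radial `V ∈ C(ℝⁿ) ∩ C^δ(B_δ)` with `V = O(⟨r⟩^{-β})`, `β > 2`
(and `V` nontrivial when `n = 2`), there is a `C²` solution of `Δφ₀ = Vφ₀` with
`φ₀ ≃ ln(r+2)` for `n = 2` and `φ₀ ≃ 1` for `n ≥ 3`; moreover for `n = 2` and `V ≡ 0` the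
constant function `1` is a solution. -/
theorem exists_bounded_eigenfunction_V_laplacian
    (n : ℕ) (hn : 2 ≤ n) (β : ℝ) (hβ : 2 < β)
    (V : Eucl n → ℝ) (hVc : Continuous V)
    (hVrad : ∀ x y : Eucl n, ‖x‖ = ‖y‖ → V x = V y)
    (hVnonneg : ∀ x, 0 ≤ V x)
    (hVdecay : ∃ Cb : ℝ, ∀ x : Eucl n, V x ≤ Cb * Real.sqrt (1 + ‖x‖ ^ 2) ^ (-β))
    (hVholder : ∃ (δ Ch : ℝ≥0), 0 < δ ∧ HolderOnWith Ch δ V (Metric.ball 0 δ))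
    (hVnontriv : n = 2 → V ≠ 0) :
    (∃ (φ : Eucl n → ℝ) (c C : ℝ), 0 < c ∧ c < C ∧
      ContDiff ℝ 2 φ ∧
      (∀ x, lap φ x = V x * φ x) ∧
      (n = 2 → ∀ x : Eucl n,
        c * Real.log (‖x‖ + 2) ≤ φ x ∧ φ x ≤ C * Real.log (‖x‖ + 2)) ∧
      (3 ≤ n → ∀ x : Eucl n, c ≤ φ x ∧ φ x ≤ C)) ∧
    (n = 2 → V = 0 → ∀ x : Eucl n, lap (fun _ => (1 : ℝ)) x = V x * 1) := by
  refine ⟨?_, fun h h0 => absurd h0 (hVnontriv h)⟩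
  obtain ⟨Cb, hCb⟩ := hVdecay
  set e : Eucl n := EuclideanSpace.single ⟨0, by omega⟩ 1 with he
  have hen : ‖e‖ = 1 := by simp [he]
  set W : ℝ → ℝ := fun q => V (√q • e) with hWdef
  have hnorm : ∀ q : ℝ, 0 ≤ q → ‖√q • e‖ ^ 2 = q := fun q hq => by
    rw [norm_smul, hen, mul_one, Real.norm_eq_abs, sq_abs, Real.sq_sqrt hq]
  have hWc : Continuous W := by fun_prop
  have hVW : ∀ x : Eucl n, V x = W (‖x‖ ^ 2) := fun x => hVrad _ _ (by
    rw [norm_smul, hen, mul_one, Real.sqrt_sq (norm_nonneg x), norm_norm])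
  have hWdecay : ∀ q, 0 ≤ q → W q ≤ |Cb| * (1 + q) ^ (-(β / 2)) := fun q hq => by
    have h := hCb (√q • e)
    rw [hnorm q hq, Real.sqrt_eq_rpow (1 + q), ← Real.rpow_mul (by linarith),
      show 1 / 2 * -β = -(β / 2) by ring] at h
    exact h.trans (by gcongr; exact le_abs_self Cb)
  have hWM : ∀ q, W q ≤ |Cb| := fun q => by
    have h : W q = W (max q 0) := by
      rcases le_total q 0 with hq | hq
      · simp [hWdef, max_eq_right hq, Real.sqrt_eq_zero_of_nonpos hq]
      · rw [max_eq_left hq]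
    rw [h]
    have hq : 0 ≤ max q 0 := le_max_right _ _
    refine (hWdecay _ hq).trans (mul_le_of_le_one_right (abs_nonneg _) ?_)
    exact Real.rpow_le_one_of_one_le_of_nonpos (by linarith) (by linarith)
  obtain ⟨G, H, hH, hH0, hHW, hG0, hG⟩ :=
    exists_radial_profile n hWc (fun q => hVnonneg _) hWM
  have hG1 : ∀ q, 0 ≤ q → 1 ≤ G q := fun q hq => hG0 ▸ monotone_of_radial hH0 hG hq
  suffices h : ∃ c C : ℝ, 0 < c ∧
      (n = 2 → ∀ x : Eucl n,
        c * Real.log (‖x‖ + 2) ≤ G (‖x‖ ^ 2) ∧ G (‖x‖ ^ 2) ≤ C * Real.log (‖x‖ + 2)) ∧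
      (3 ≤ n → ∀ x : Eucl n, c ≤ G (‖x‖ ^ 2) ∧ G (‖x‖ ^ 2) ≤ C) by
    obtain ⟨c, C, hc, h2, h3⟩ := h
    refine ⟨fun x => G (‖x‖ ^ 2), c, max C (c + 1), hc,
      (lt_add_one c).trans_le (le_max_right _ _), contDiff_radial (by omega) hH hG,
      fun x => ?_, fun hn x => ⟨(h2 hn x).1, (h2 hn x).2.trans ?_⟩,
      fun hn x => ⟨(h3 hn x).1, (h3 hn x).2.trans (le_max_left _ _)⟩⟩
    · rw [lap_radial (by omega) hH hG, hHW _ (sq_nonneg _), hVW]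
    · have : 0 ≤ log (‖x‖ + 2) := Real.log_nonneg (by linarith [norm_nonneg x])
      gcongr
      exact le_max_left _ _
  rcases hn.eq_or_lt with rfl | hn3
  · obtain ⟨x₀, hx₀⟩ := Function.ne_iff.1 (hVnontriv rfl)
    have hpos : 0 < H (‖x₀‖ ^ 2) := by
      rw [hHW _ (sq_nonneg _), ← hVW]
      exact mul_pos ((hVnonneg x₀).lt_of_ne' hx₀)
        (zero_lt_one.trans_le (hG1 _ (sq_nonneg _)))
    obtain ⟨c, hc, hcG⟩ := log_le_radial_two hH hH0 hG0 hG (sq_nonneg _) hpos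
    obtain ⟨C, hCG⟩ := radial_two_le_log hH hH0 hHW hG0 hG (abs_nonneg Cb)
      (by linarith : 1 < β / 2) hWdecay
    exact ⟨c, C, hc, fun _ x => ⟨hcG _ (norm_nonneg x), hCG _ (norm_nonneg x)⟩,
      fun h => absurd h (by norm_num)⟩
  · obtain ⟨C, hC⟩ := radial_le_of_three_le hn3 hH hH0 hHW hG0 hG (abs_nonneg Cb)
      (by linarith : 1 < β / 2) hWdecay
    exact ⟨1, C, one_pos, fun h => by omega,
      fun _ x => ⟨hG1 _ (sq_nonneg _), hC _ (sq_nonneg _)⟩⟩
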